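/- In the Hopf–Galois coextension setting, for every c ∈ C^D the element c⁽³⁾⊗c⁽¹⁾ lies in C□_D C, and the linear map ρ : C^D → H⊗C, ρ(c) = κ(c⁽³⁾⊗c⁽¹⁾) ⊗ c⁽²⁾, takes values in H⊗C^D and makes C^D, with the restricted right H-action, a right-left stable anti-Yetter–Drinfeld module over H; that is: (a) ρ is a coassociative and counital left H-coaction on C^D; (b) the anti-Yetter–Drinfeld condition holds: ρ(c·h) = S(h⁽³⁾)·κ(c⁽³⁾⊗c⁽¹⁾)·h⁽¹⁾ ⊗ c⁽²⁾·h⁽²⁾ for all c ∈ C^D, h ∈ H; (c) stability holds: c⁽²⁾·κ(c⁽³⁾⊗c⁽¹⁾) = c for all c ∈ C^D. -/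

import Mathlib

open TensorProduct

noncomputable section

namespace Gal

variable (C D H : Type*) [Ring H] [HopfAlgebra ℂ H]
  [AddCommGroup C] [Module ℂ C] [Coalgebra ℂ C]
  [AddCommGroup D] [Module ℂ D] [Coalgebra ℂ D]

/-- `c ⊗ c' ↦ c⁽¹⁾ ⊗ (π(c⁽²⁾) ⊗ c')`. -/
def cotL (π : C →ₗ[ℂ] D) : C ⊗[ℂ] C →ₗ[ℂ] C ⊗[ℂ] (D ⊗[ℂ] C) :=
  (TensorProduct.assoc ℂ C D C).toLinearMap
    ∘ₗ LinearMap.rTensor C (LinearMap.lTensor C π ∘ₗ Coalgebra.comul (R := ℂ))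

/-- `c ⊗ c' ↦ c ⊗ (π(c'⁽¹⁾) ⊗ c'⁽²⁾)`. -/
def cotR (π : C →ₗ[ℂ] D) : C ⊗[ℂ] C →ₗ[ℂ] C ⊗[ℂ] (D ⊗[ℂ] C) :=
  LinearMap.lTensor C (LinearMap.rTensor C π ∘ₗ Coalgebra.comul (R := ℂ))

/-- The cotensor product `C □_D C` as a subspace of `C ⊗ C`. -/
def cot (π : C →ₗ[ℂ] D) : Submodule ℂ (C ⊗[ℂ] C) :=
  LinearMap.eqLocus (cotL C D π) (cotR C D π)

/-- The canonical map `β : C ⊗ H → C ⊗ C`, `c ⊗ h ↦ c⁽¹⁾ ⊗ c⁽²⁾ · h`. -/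
def βcan (act : C ⊗[ℂ] H →ₗ[ℂ] C) : C ⊗[ℂ] H →ₗ[ℂ] C ⊗[ℂ] C :=
  LinearMap.lTensor C act ∘ₗ (TensorProduct.assoc ℂ C C H).toLinearMap
    ∘ₗ LinearMap.rTensor H (Coalgebra.comul (R := ℂ))

/-- `κ = (ε ⊗ id_H) ∘ β⁻¹ : C □_D C → H` (computed with a linear extension of
`β⁻¹` to all of `C ⊗ C`; on `C □_D C` it does not depend on the extension). -/
def κ (βinv : C ⊗[ℂ] C →ₗ[ℂ] C ⊗[ℂ] H) : C ⊗[ℂ] C →ₗ[ℂ] H :=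
  (TensorProduct.lid ℂ H).toLinearMap
    ∘ₗ LinearMap.rTensor H (Coalgebra.counit (R := ℂ)) ∘ₗ βinv

/-- The Hopf–Galois coextension setting: `C` is a right `H`-module coalgebra
via `act`, `π : C → D` is a surjective coalgebra map whose kernel is spanned by
`{c · h - ε(h) c}`, the canonical map `β` is injective with image exactly
`C □_D C`, and `βinv` is a linear map restricting on `C □_D C` to the inverse
of (the corestriction of) `β`. -/
structure IsGaloisCoextension (act : C ⊗[ℂ] H →ₗ[ℂ] C) (π : C →ₗ[ℂ] D)
    (βinv : C ⊗[ℂ] C →ₗ[ℂ] C ⊗[ℂ] H) : Prop where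
  act_one : ∀ c : C, act (c ⊗ₜ[ℂ] 1) = c
  act_mul : ∀ (c : C) (h h' : H),
    act (act (c ⊗ₜ[ℂ] h) ⊗ₜ[ℂ] h') = act (c ⊗ₜ[ℂ] (h * h'))
  comul_act : Coalgebra.comul (R := ℂ) ∘ₗ act
    = TensorProduct.map act act
        ∘ₗ (TensorProduct.tensorTensorTensorComm ℂ C C H H).toLinearMap
        ∘ₗ TensorProduct.map (Coalgebra.comul (R := ℂ)) (Coalgebra.comul (R := ℂ))
  counit_act : Coalgebra.counit (R := ℂ) ∘ₗ act
    = LinearMap.mul' ℂ ℂ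
        ∘ₗ TensorProduct.map (Coalgebra.counit (R := ℂ)) (Coalgebra.counit (R := ℂ))
  comul_π : Coalgebra.comul (R := ℂ) ∘ₗ π
    = TensorProduct.map π π ∘ₗ Coalgebra.comul (R := ℂ)
  counit_π : Coalgebra.counit (R := ℂ) ∘ₗ π = Coalgebra.counit (R := ℂ)
  π_surjective : Function.Surjective π
  ker_π : LinearMap.ker π
    = Submodule.span ℂ {x : C | ∃ (c : C) (h : H),
        x = act (c ⊗ₜ[ℂ] h) - (Coalgebra.counit (R := ℂ) h) • c}
  β_mem_cot : ∀ y : C ⊗[ℂ] H, βcan C H act y ∈ cot C D π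
  βinv_β : ∀ y : C ⊗[ℂ] H, βinv (βcan C H act y) = y
  β_βinv : ∀ x ∈ cot C D π, βcan C H act (βinv x) = x


/-- `C^D = {c ∈ C : c⁽¹⁾ ⊗ π(c⁽²⁾) = c⁽²⁾ ⊗ π(c⁽¹⁾)}`. -/
def CD (π : C →ₗ[ℂ] D) : Submodule ℂ C :=
  LinearMap.eqLocus
    (LinearMap.lTensor C π ∘ₗ Coalgebra.comul (R := ℂ))
    (LinearMap.lTensor C π ∘ₗ (TensorProduct.comm ℂ C C).toLinearMap
      ∘ₗ Coalgebra.comul (R := ℂ))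

/-- `W (c) = (c⁽³⁾ ⊗ c⁽¹⁾) ⊗ c⁽²⁾`. -/
def W : C →ₗ[ℂ] (C ⊗[ℂ] C) ⊗[ℂ] C :=
  (TensorProduct.assoc ℂ C C C).symm.toLinearMap
    ∘ₗ (TensorProduct.comm ℂ (C ⊗[ℂ] C) C).toLinearMap
    ∘ₗ LinearMap.rTensor C (Coalgebra.comul (R := ℂ))
    ∘ₗ Coalgebra.comul (R := ℂ)

/-- The coaction `ρ (c) = κ(c⁽³⁾ ⊗ c⁽¹⁾) ⊗ c⁽²⁾`. -/
def ρmap (βinv : C ⊗[ℂ] C →ₗ[ℂ] C ⊗[ℂ] H) : C →ₗ[ℂ] H ⊗[ℂ] C :=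
  LinearMap.rTensor C (κ C H βinv) ∘ₗ W C

/-- `Θ (h) = h⁽¹⁾ ⊗ (h⁽²⁾ ⊗ S(h⁽³⁾))`. -/
def Θ : H →ₗ[ℂ] H ⊗[ℂ] (H ⊗[ℂ] H) :=
  LinearMap.lTensor H (LinearMap.lTensor H (HopfAlgebra.antipode (R := ℂ)))
    ∘ₗ (TensorProduct.assoc ℂ H H H).toLinearMap
    ∘ₗ LinearMap.rTensor H (Coalgebra.comul (R := ℂ))
    ∘ₗ Coalgebra.comul (R := ℂ)

/-- The right-hand side of the anti-Yetter–Drinfeld condition, as a linear map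
`(H ⊗ C) ⊗ H → H ⊗ C`: `(k ⊗ c₀) ⊗ h ↦ S(h⁽³⁾) k h⁽¹⁾ ⊗ c₀ · h⁽²⁾`. -/
def aydRHS (act : C ⊗[ℂ] H →ₗ[ℂ] C) : (H ⊗[ℂ] C) ⊗[ℂ] H →ₗ[ℂ] H ⊗[ℂ] C :=
  LinearMap.rTensor C (LinearMap.mul' ℂ H)
    ∘ₗ (TensorProduct.assoc ℂ H H C).symm.toLinearMap
    ∘ₗ (TensorProduct.comm ℂ (H ⊗[ℂ] C) H).toLinearMap
    ∘ₗ (TensorProduct.assoc ℂ H C H).symm.toLinearMap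
    ∘ₗ TensorProduct.map (LinearMap.mul' ℂ H)
        (LinearMap.rTensor H act ∘ₗ (TensorProduct.assoc ℂ C H H).symm.toLinearMap)
    ∘ₗ (TensorProduct.tensorTensorTensorComm ℂ H C H (H ⊗[ℂ] H)).toLinearMap
    ∘ₗ LinearMap.lTensor (H ⊗[ℂ] C) (Θ H)

section helpers

set_option linter.all false

set_option linter.unusedSectionVars false

set_option linter.unusedSimpArgs false

open Coalgebra

/-- Finite set of pairs representing `comul x`. -/
def Rp {A : Type*} [AddCommGroup A] [Module ℂ A] [Coalgebra ℂ A] (x : A) : Finset (A × A) :=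
  (Coalgebra.Repr.arbitrary ℂ x).index

variable {A : Type*} [AddCommGroup A] [Module ℂ A] [Coalgebra ℂ A]

lemma comul_eq (x : A) : comul (R := ℂ) x = ∑ i ∈ Rp x, i.1 ⊗ₜ[ℂ] i.2 :=
  (Coalgebra.Repr.arbitrary ℂ x).eq.symm

lemma coas {M : Type*} [AddCommGroup M] [Module ℂ M] (x : A)
    (T : A ⊗[ℂ] (A ⊗[ℂ] A) →ₗ[ℂ] M) :
    ∑ i ∈ Rp x, ∑ j ∈ Rp i.1, T (j.1 ⊗ₜ (j.2 ⊗ₜ i.2))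
      = ∑ i ∈ Rp x, ∑ j ∈ Rp i.2, T (i.1 ⊗ₜ (j.1 ⊗ₜ j.2)) := by
  have h := congrArg T (coassoc_apply (R := ℂ) x)
  simpa [comul_eq, sum_tmul, tmul_sum] using h

lemma cou_l {M : Type*} [AddCommGroup M] [Module ℂ M] (x : A) (T : A →ₗ[ℂ] M) :
    ∑ i ∈ Rp x, counit (R := ℂ) i.1 • T i.2 = T x := by
  have h := congrArg (fun z => T (TensorProduct.lid ℂ A z)) (rTensor_counit_comul (R := ℂ) x)
  simpa [comul_eq] using h

lemma cou_r {M : Type*} [AddCommGroup M] [Module ℂ M] (x : A) (T : A →ₗ[ℂ] M) :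
    ∑ i ∈ Rp x, counit (R := ℂ) i.2 • T i.1 = T x := by
  have h := congrArg (fun z => T (TensorProduct.rid ℂ A z)) (lTensor_counit_comul (R := ℂ) x)
  simpa [comul_eq] using h

variable {C D H : Type*} [Ring H] [HopfAlgebra ℂ H]
    [AddCommGroup C] [Module ℂ C] [Coalgebra ℂ C]
    [AddCommGroup D] [Module ℂ D] [Coalgebra ℂ D]

/-- action of a fixed element -/
def ac (act : C ⊗[ℂ] H →ₗ[ℂ] C) (h : H) : C →ₗ[ℂ] C :=
  act ∘ₗ (TensorProduct.mk ℂ C H).flip h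

@[simp] lemma ac_apply (act : C ⊗[ℂ] H →ₗ[ℂ] C) (h : H) (c : C) :
    ac act h c = act (c ⊗ₜ h) := rfl

variable {act : C ⊗[ℂ] H →ₗ[ℂ] C} {π : C →ₗ[ℂ] D} {βinv : C ⊗[ℂ] C →ₗ[ℂ] C ⊗[ℂ] H}

lemma antip (x : H) :
    ∑ i ∈ Rp x, i.1 * HopfAlgebra.antipode ℂ i.2 = counit (R := ℂ) x • 1 :=
  HopfAlgebra.sum_mul_antipode_eq_smul (R := ℂ) (Coalgebra.Repr.arbitrary ℂ x)

lemma β_tmul (c : C) (h : H) :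
    βcan C H act (c ⊗ₜ h) = ∑ i ∈ Rp c, i.1 ⊗ₜ act (i.2 ⊗ₜ h) := by
  simp [βcan, comul_eq, sum_tmul]

lemma comul_ac (hg : IsGaloisCoextension C D H act π βinv) (c : C) (h : H) :
    comul (R := ℂ) (act (c ⊗ₜ h))
      = ∑ i ∈ Rp c, ∑ j ∈ Rp h, act (i.1 ⊗ₜ j.1) ⊗ₜ[ℂ] act (i.2 ⊗ₜ j.2) := by
  have := LinearMap.congr_fun hg.comul_act (c ⊗ₜ h)
  rw [Finset.sum_comm]
  simpa [comul_eq c, comul_eq h, sum_tmul, tmul_sum] using this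

lemma counit_ac (hg : IsGaloisCoextension C D H act π βinv) (c : C) (h : H) :
    counit (R := ℂ) (act (c ⊗ₜ h)) = counit (R := ℂ) c * counit (R := ℂ) h := by
  simpa using LinearMap.congr_fun hg.counit_act (c ⊗ₜ h)

lemma π_ac (hg : IsGaloisCoextension C D H act π βinv) (c : C) (h : H) :
    π (act (c ⊗ₜ h)) = counit (R := ℂ) h • π c := by
  have : act (c ⊗ₜ[ℂ] h) - (Coalgebra.counit (R := ℂ) h) • c ∈ LinearMap.ker π := by
    rw [hg.ker_π]; exact Submodule.subset_span ⟨c, h, rfl⟩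
  rw [LinearMap.mem_ker, map_sub, map_smul, sub_eq_zero] at this
  exact this

lemma κ_β (hg : IsGaloisCoextension C D H act π βinv) (c : C) (h : H) :
    κ C H βinv (βcan C H act (c ⊗ₜ h)) = counit (R := ℂ) c • h := by
  simp [κ, hg.βinv_β]

lemma κ_sum (hg : IsGaloisCoextension C D H act π βinv) (c : C) (h : H) :
    ∑ i ∈ Rp c, κ C H βinv (i.1 ⊗ₜ act (i.2 ⊗ₜ h)) = counit (R := ℂ) c • h := by
  rw [← κ_β hg, β_tmul, map_sum]

/-- `(1 ⊗ π) Δ (c h) = c⁽¹⁾ h ⊗ π c⁽²⁾`. -/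
lemma comul_ac_π (hg : IsGaloisCoextension C D H act π βinv) (c : C) (h : H) :
    ∑ i ∈ Rp (act (c ⊗ₜ h)), i.1 ⊗ₜ[ℂ] π i.2 = ∑ i ∈ Rp c, act (i.1 ⊗ₜ h) ⊗ₜ[ℂ] π i.2 := by
  have := congrArg (LinearMap.lTensor C π) (comul_ac hg c h)
  rw [comul_eq] at this
  simp only [map_sum, LinearMap.lTensor_tmul, π_ac hg, tmul_smul] at this
  rw [this]
  refine Finset.sum_congr rfl fun i _ => ?_
  simpa using cou_r h ((TensorProduct.mk ℂ C D).flip (π i.2) ∘ₗ act ∘ₗ TensorProduct.mk ℂ C H i.1)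

lemma comul_ac_π' (hg : IsGaloisCoextension C D H act π βinv) (c : C) (h : H) :
    ∑ i ∈ Rp (act (c ⊗ₜ h)), i.2 ⊗ₜ[ℂ] π i.1 = ∑ i ∈ Rp c, act (i.2 ⊗ₜ h) ⊗ₜ[ℂ] π i.1 := by
  have := congrArg (LinearMap.lTensor C π ∘ₗ (TensorProduct.comm ℂ C C).toLinearMap)
    (comul_ac hg c h)
  rw [comul_eq] at this
  simp only [map_sum, LinearMap.comp_apply, LinearEquiv.coe_coe, comm_tmul,
    LinearMap.lTensor_tmul, π_ac hg, tmul_smul] at this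
  rw [this]
  refine Finset.sum_congr rfl fun i _ => ?_
  simpa using cou_l h ((TensorProduct.mk ℂ C D).flip (π i.1) ∘ₗ act ∘ₗ TensorProduct.mk ℂ C H i.2)

lemma mem_CD_iff (c : C) : c ∈ CD C D π ↔
    ∑ i ∈ Rp c, i.1 ⊗ₜ[ℂ] π i.2 = ∑ i ∈ Rp c, i.2 ⊗ₜ[ℂ] π i.1 := by
  simp [CD, LinearMap.mem_eqLocus, comul_eq]

lemma ac_mem_CD (hg : IsGaloisCoextension C D H act π βinv) {c : C} (hc : c ∈ CD C D π) (h : H) :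
    act (c ⊗ₜ h) ∈ CD C D π := by
  rw [mem_CD_iff] at hc ⊢
  rw [comul_ac_π hg, comul_ac_π' hg]
  simpa using congrArg (LinearMap.rTensor D (ac act h)) hc

lemma W_eq (c : C) : W C c = ∑ i ∈ Rp c, ∑ j ∈ Rp i.1, (i.2 ⊗ₜ j.1) ⊗ₜ[ℂ] j.2 := by
  simp [W, comul_eq, sum_tmul, tmul_sum]

lemma W_eqL (c : C) : LinearMap.rTensor C (cotL C D π) (W C c)
    = ∑ i ∈ Rp c, ∑ m ∈ Rp i.1, ∑ j ∈ Rp m.1, (m.2 ⊗ₜ (π i.2 ⊗ₜ j.1)) ⊗ₜ[ℂ] j.2 := by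
  -- `(x, (y, z)) ↦ (y ⊗ (π z ⊗ x₁)) ⊗ x₂`
  let E : (C ⊗[ℂ] C) ⊗[ℂ] (C ⊗[ℂ] C) →ₗ[ℂ] (C ⊗[ℂ] (D ⊗[ℂ] C)) ⊗[ℂ] C :=
    LinearMap.rTensor C (TensorProduct.assoc ℂ C D C).toLinearMap ∘ₗ
    (TensorProduct.assoc ℂ (C ⊗[ℂ] D) C C).symm.toLinearMap ∘ₗ
    LinearMap.rTensor (C ⊗[ℂ] C) (LinearMap.lTensor C π) ∘ₗ
    (TensorProduct.comm ℂ (C ⊗[ℂ] C) (C ⊗[ℂ] C)).toLinearMap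
  have := coas c (E ∘ₗ LinearMap.rTensor (C ⊗[ℂ] C) (comul (R := ℂ)))
  simp [E, comul_eq, sum_tmul, tmul_sum] at this
  rw [this, W_eq]
  simp [cotL, comul_eq, sum_tmul, tmul_sum]
  refine Finset.sum_congr rfl fun i _ => ?_
  rw [Finset.sum_comm]

lemma W_eqR (c : C) : LinearMap.rTensor C (cotR C D π) (W C c)
    = ∑ i ∈ Rp c, ∑ m ∈ Rp i.2, ∑ j ∈ Rp m.1, (m.2 ⊗ₜ (π i.1 ⊗ₜ j.1)) ⊗ₜ[ℂ] j.2 := by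
  -- `(x, (y, w), z) ↦ (z ⊗ (π x ⊗ y)) ⊗ w`
  let E : C ⊗[ℂ] ((C ⊗[ℂ] C) ⊗[ℂ] C) →ₗ[ℂ] (C ⊗[ℂ] (D ⊗[ℂ] C)) ⊗[ℂ] C :=
    (TensorProduct.assoc ℂ C (D ⊗[ℂ] C) C).symm.toLinearMap ∘ₗ
    LinearMap.lTensor C (LinearMap.rTensor C (LinearMap.rTensor C π)) ∘ₗ
    LinearMap.lTensor C (TensorProduct.assoc ℂ C C C).symm.toLinearMap ∘ₗ
    (TensorProduct.comm ℂ (C ⊗[ℂ] (C ⊗[ℂ] C)) C).toLinearMap ∘ₗ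
    (TensorProduct.assoc ℂ C (C ⊗[ℂ] C) C).symm.toLinearMap
  have := coas c (E ∘ₗ LinearMap.lTensor C (LinearMap.rTensor C (comul (R := ℂ))))
  simp [E, comul_eq, sum_tmul, tmul_sum] at this
  rw [← this, W_eq]
  simp [cotR, comul_eq, sum_tmul, tmul_sum]
  refine Finset.sum_congr rfl fun i _ => ?_
  -- `(x, (y, w)) ↦ (z ⊗ (π x ⊗ y)) ⊗ w`
  have := coas i.1 (E ∘ₗ LinearMap.lTensor C ((TensorProduct.mk ℂ (C ⊗[ℂ] C) C).flip i.2))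
  simpa [E] using this

lemma W_loc {c : C} (hc : c ∈ CD C D π) :
    LinearMap.rTensor C (cotL C D π) (W C c) = LinearMap.rTensor C (cotR C D π) (W C c) := by
  rw [W_eqL, W_eqR]
  rw [mem_CD_iff] at hc
  -- `(x, d) ↦ (x₂ ⊗ (d ⊗ x₁₁)) ⊗ x₁₂`
  let E : ((C ⊗[ℂ] C) ⊗[ℂ] C) ⊗[ℂ] D →ₗ[ℂ] (C ⊗[ℂ] (D ⊗[ℂ] C)) ⊗[ℂ] C :=
    (TensorProduct.assoc ℂ C (D ⊗[ℂ] C) C).symm.toLinearMap ∘ₗ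
    LinearMap.lTensor C (TensorProduct.assoc ℂ D C C).symm.toLinearMap ∘ₗ
    LinearMap.lTensor C (TensorProduct.comm ℂ (C ⊗[ℂ] C) D).toLinearMap ∘ₗ
    (TensorProduct.assoc ℂ C (C ⊗[ℂ] C) D).toLinearMap ∘ₗ
    LinearMap.rTensor D (TensorProduct.comm ℂ (C ⊗[ℂ] C) C).toLinearMap
  have := congrArg (E ∘ₗ LinearMap.rTensor D
    (LinearMap.rTensor C (comul (R := ℂ)) ∘ₗ comul (R := ℂ))) hc
  simpa [E, comul_eq, sum_tmul, tmul_sum] using this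

lemma W_mem {c : C} (hc : c ∈ CD C D π) :
    W C c ∈ LinearMap.range (LinearMap.rTensor C (cot C D π).subtype) := by
  have h : Function.Exact (cot C D π).subtype (cotL C D π - cotR C D π) := by
    rw [cot, LinearMap.eqLocus_eq_ker_sub]
    exact LinearMap.exact_subtype_ker_map _
  have h2 := Module.Flat.rTensor_exact C h
  refine (h2 _).1 ?_
  rw [LinearMap.rTensor_sub, LinearMap.sub_apply, W_loc hc, sub_self]

lemma W_transfer (hg : IsGaloisCoextension C D H act π βinv) {M : Type*} [AddCommGroup M]
    [Module ℂ M] (F G : C ⊗[ℂ] C →ₗ[ℂ] M)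
    (hFG : ∀ (c : C) (h : H), F (βcan C H act (c ⊗ₜ h)) = G (βcan C H act (c ⊗ₜ h)))
    {c : C} (hc : c ∈ CD C D π) :
    LinearMap.rTensor C F (W C c) = LinearMap.rTensor C G (W C c) := by
  obtain ⟨z, hz⟩ := W_mem hc
  have h1 : F ∘ₗ βcan C H act = G ∘ₗ βcan C H act := TensorProduct.ext' hFG
  have h2 : F ∘ₗ (cot C D π).subtype = G ∘ₗ (cot C D π).subtype := by
    ext ⟨x, hx⟩
    have := LinearMap.congr_fun h1 (βinv x)
    simpa [hg.β_βinv x hx] using this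
  rw [← hz, ← LinearMap.comp_apply, ← LinearMap.comp_apply, ← LinearMap.rTensor_comp,
    ← LinearMap.rTensor_comp, h2]

/-- `a ⊗ b ↦ κ(a⁽²⁾ ⊗ b) ⊗ π a⁽¹⁾` -/
def F2 (π : C →ₗ[ℂ] D) (βinv : C ⊗[ℂ] C →ₗ[ℂ] C ⊗[ℂ] H) : C ⊗[ℂ] C →ₗ[ℂ] H ⊗[ℂ] D :=
  (TensorProduct.comm ℂ D H).toLinearMap ∘ₗ TensorProduct.map π (κ C H βinv) ∘ₗ
    (TensorProduct.assoc ℂ C C C).toLinearMap ∘ₗ LinearMap.rTensor C (comul (R := ℂ))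

/-- `a ⊗ b ↦ κ(a ⊗ b⁽¹⁾) ⊗ π b⁽²⁾` -/
def G2 (π : C →ₗ[ℂ] D) (βinv : C ⊗[ℂ] C →ₗ[ℂ] C ⊗[ℂ] H) : C ⊗[ℂ] C →ₗ[ℂ] H ⊗[ℂ] D :=
  TensorProduct.map (κ C H βinv) π ∘ₗ
    (TensorProduct.assoc ℂ C C C).symm.toLinearMap ∘ₗ LinearMap.lTensor C (comul (R := ℂ))

lemma F2_apply (a b : C) : F2 π βinv (a ⊗ₜ b)
    = ∑ i ∈ Rp a, κ C H βinv (i.2 ⊗ₜ b) ⊗ₜ[ℂ] π i.1 := by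
  simp [F2, comul_eq, sum_tmul]

lemma G2_apply (a b : C) : G2 π βinv (a ⊗ₜ b)
    = ∑ i ∈ Rp b, κ C H βinv (a ⊗ₜ i.1) ⊗ₜ[ℂ] π i.2 := by
  simp [G2, comul_eq, tmul_sum]

lemma F2_β (hg : IsGaloisCoextension C D H act π βinv) (c : C) (h : H) :
    F2 π βinv (βcan C H act (c ⊗ₜ h)) = h ⊗ₜ π c := by
  simp only [β_tmul, map_sum, F2_apply]
  have := coas c ((TensorProduct.comm ℂ D H).toLinearMap ∘ₗ
    TensorProduct.map π (κ C H βinv ∘ₗ LinearMap.lTensor C (ac act h)))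
  simp at this
  rw [this]
  simp only [← sum_tmul, κ_sum hg]
  simpa [smul_tmul'] using cou_r c (TensorProduct.mk ℂ H D h ∘ₗ π)

lemma G2_β (hg : IsGaloisCoextension C D H act π βinv) (c : C) (h : H) :
    G2 π βinv (βcan C H act (c ⊗ₜ h)) = h ⊗ₜ π c := by
  simp only [β_tmul, map_sum, G2_apply]
  have h1 : ∀ a b : C, ∑ i ∈ Rp (act (b ⊗ₜ h)), κ C H βinv (a ⊗ₜ i.1) ⊗ₜ[ℂ] π i.2
      = ∑ i ∈ Rp b, κ C H βinv (a ⊗ₜ act (i.1 ⊗ₜ h)) ⊗ₜ[ℂ] π i.2 := by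
    intro a b
    simpa using congrArg (LinearMap.rTensor D (κ C H βinv ∘ₗ TensorProduct.mk ℂ C C a))
      (comul_ac_π hg b h)
  simp only [h1]
  have := coas c (TensorProduct.map (κ C H βinv ∘ₗ LinearMap.lTensor C (ac act h)) π ∘ₗ
    (TensorProduct.assoc ℂ C C C).symm.toLinearMap)
  simp at this
  rw [← this]
  simp only [← sum_tmul, κ_sum hg]
  simpa [smul_tmul'] using cou_l c (TensorProduct.mk ℂ H D h ∘ₗ π)

lemma ρ_eq (c : C) : ρmap C H βinv c
    = ∑ i ∈ Rp c, ∑ j ∈ Rp i.1, κ C H βinv (i.2 ⊗ₜ j.1) ⊗ₜ[ℂ] j.2 := by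
  simp [ρmap, W_eq]

lemma ρ_mem (hg : IsGaloisCoextension C D H act π βinv) {c : C} (hc : c ∈ CD C D π) :
    ρmap C H βinv c ∈ LinearMap.range (LinearMap.lTensor H (CD C D π).subtype) := by
  let f : C →ₗ[ℂ] C ⊗[ℂ] D := LinearMap.lTensor C π ∘ₗ comul (R := ℂ)
  let g : C →ₗ[ℂ] C ⊗[ℂ] D := LinearMap.lTensor C π ∘ₗ (TensorProduct.comm ℂ C C).toLinearMap
      ∘ₗ comul (R := ℂ)
  have h : Function.Exact (CD C D π).subtype (f - g) := by
    rw [CD, LinearMap.eqLocus_eq_ker_sub]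
    exact LinearMap.exact_subtype_ker_map _
  refine (Module.Flat.lTensor_exact H h _).1 ?_
  rw [LinearMap.lTensor_sub, LinearMap.sub_apply, sub_eq_zero]
  have key := W_transfer hg (F2 π βinv) (G2 π βinv)
    (fun c h => by rw [F2_β hg, G2_β hg]) hc
  have key' := congrArg (LinearMap.lTensor H (TensorProduct.comm ℂ D C).toLinearMap ∘ₗ
    (TensorProduct.assoc ℂ H D C).toLinearMap) key
  simp [W_eq, F2_apply, G2_apply, sum_tmul] at key'
  rw [ρ_eq]
  simp [f, g, comul_eq, tmul_sum]
  -- LHS : `κ(c4 ⊗ c1) ⊗ c2 ⊗ π c3`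
  have e1 : ∀ i : C × C, ∑ j ∈ Rp i.1, ∑ k ∈ Rp j.2,
      κ C H βinv (i.2 ⊗ₜ j.1) ⊗ₜ[ℂ] (k.1 ⊗ₜ[ℂ] π k.2)
      = ∑ j ∈ Rp i.1, ∑ k ∈ Rp j.1, κ C H βinv (i.2 ⊗ₜ k.1) ⊗ₜ[ℂ] (k.2 ⊗ₜ[ℂ] π j.2) := by
    intro i
    have := coas i.1 (TensorProduct.map (κ C H βinv ∘ₗ TensorProduct.mk ℂ C C i.2)
      (LinearMap.lTensor C π))
    simpa using this.symm
  have e2 : ∀ i : C × C, ∑ j ∈ Rp i.1, ∑ k ∈ Rp j.2,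
      κ C H βinv (i.2 ⊗ₜ j.1) ⊗ₜ[ℂ] (k.2 ⊗ₜ[ℂ] π k.1)
      = ∑ j ∈ Rp i.1, ∑ k ∈ Rp j.1, κ C H βinv (i.2 ⊗ₜ k.1) ⊗ₜ[ℂ] (j.2 ⊗ₜ[ℂ] π k.2) := by
    intro i
    have := coas i.1 (TensorProduct.map (κ C H βinv ∘ₗ TensorProduct.mk ℂ C C i.2)
      (LinearMap.lTensor C π ∘ₗ (TensorProduct.comm ℂ C C).toLinearMap))
    simpa using this.symm
  simp only [e1, e2]
  rw [← key']
  -- `(x, (y, z)) ↦ κ(z ⊗ x₁) ⊗ (x₂ ⊗ π y)`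
  let E : (C ⊗[ℂ] C) ⊗[ℂ] (C ⊗[ℂ] C) →ₗ[ℂ] H ⊗[ℂ] (C ⊗[ℂ] D) :=
    TensorProduct.map (κ C H βinv) (LinearMap.lTensor C π ∘ₗ (TensorProduct.comm ℂ C C).toLinearMap) ∘ₗ
    (TensorProduct.tensorTensorTensorComm ℂ C C C C).toLinearMap ∘ₗ
    (TensorProduct.comm ℂ (C ⊗[ℂ] C) (C ⊗[ℂ] C)).toLinearMap ∘ₗ
    LinearMap.lTensor (C ⊗[ℂ] C) (TensorProduct.comm ℂ C C).toLinearMap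
  have := coas c (E ∘ₗ LinearMap.rTensor (C ⊗[ℂ] C) (comul (R := ℂ)))
  simp [E, comul_eq, sum_tmul, tmul_sum] at this
  rw [this]
  refine Finset.sum_congr rfl fun i _ => ?_
  rw [Finset.sum_comm]

lemma κ_counit (hg : IsGaloisCoextension C D H act π βinv) {c : C} (hc : c ∈ CD C D π) :
    (TensorProduct.lid ℂ C)
      (LinearMap.rTensor C (Coalgebra.counit (R := ℂ)) (ρmap C H βinv c)) = c := by
  have key := W_transfer hg (counit (R := ℂ) ∘ₗ κ C H βinv)
    (LinearMap.mul' ℂ ℂ ∘ₗ TensorProduct.map (counit (R := ℂ)) (counit (R := ℂ)))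
    (fun c h => by
      rw [LinearMap.comp_apply, κ_β hg, β_tmul]
      simp [counit_ac hg]
      have := cou_l c (counit (R := ℂ))
      simp only [smul_eq_mul] at this
      simp only [← mul_assoc, ← Finset.sum_mul, this]) hc
  rw [LinearMap.rTensor_comp, LinearMap.comp_apply] at key
  rw [ρmap, LinearMap.comp_apply, key, W_eq]
  simp only [map_sum, LinearMap.rTensor_tmul, LinearMap.comp_apply, map_tmul,
    LinearMap.mul'_apply, lid_tmul, mul_smul, ← Finset.smul_sum]
  have h1 : ∀ x : C, ∑ j ∈ Rp x, counit (R := ℂ) j.1 • j.2 = x := fun x => by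
    simpa using cou_l x LinearMap.id
  simp only [h1]
  simpa using cou_r c LinearMap.id

lemma stab (hg : IsGaloisCoextension C D H act π βinv) {c : C} (hc : c ∈ CD C D π) :
    act ((TensorProduct.comm ℂ H C) (ρmap C H βinv c)) = c := by
  -- `a ⊗ b ↦ a⁽¹⁾ κ(a⁽²⁾ ⊗ b)`
  let F : C ⊗[ℂ] C →ₗ[ℂ] C := act ∘ₗ LinearMap.lTensor C (κ C H βinv) ∘ₗ
    (TensorProduct.assoc ℂ C C C).toLinearMap ∘ₗ LinearMap.rTensor C (comul (R := ℂ))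
  let G : C ⊗[ℂ] C →ₗ[ℂ] C := (TensorProduct.lid ℂ C).toLinearMap ∘ₗ
    LinearMap.rTensor C (counit (R := ℂ))
  have key := W_transfer hg F G (fun c h => by
    rw [β_tmul]
    simp [F, G, comul_eq, sum_tmul]
    have := coas c (act ∘ₗ LinearMap.lTensor C (κ C H βinv ∘ₗ LinearMap.lTensor C (ac act h)))
    simp at this
    rw [this]
    simp only [← map_sum, ← tmul_sum, κ_sum hg]
    have h1 := cou_r c (ac act h)
    have h2 := cou_l c (ac act h)
    simp at h1 h2
    simp [h1, h2]) hc
  have key' := congrArg ((TensorProduct.rid ℂ C).toLinearMap ∘ₗ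
    LinearMap.lTensor C (counit (R := ℂ))) key
  simp [W_eq, F, G, comul_eq, sum_tmul] at key'
  -- right side
  have r : ∑ i ∈ Rp c, ∑ j ∈ Rp i.1, counit (R := ℂ) j.2 • counit (R := ℂ) i.2 • j.1 = c := by
    have h1 : ∀ x : C, ∑ j ∈ Rp x, counit (R := ℂ) j.2 • j.1 = x := fun x => by
      simpa using cou_r x LinearMap.id
    simp only [fun (i j : C × C) => smul_comm (counit (R := ℂ) j.2) (counit (R := ℂ) i.2) j.1,
      ← Finset.smul_sum, h1]
  rw [r] at key'
  rw [ρ_eq]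
  simp
  conv_rhs => rw [← key']
  -- left side
  have l : ∀ i : C × C, ∑ j ∈ Rp i.1, ∑ k ∈ Rp i.2,
      counit (R := ℂ) j.2 • act (k.1 ⊗ₜ κ C H βinv (k.2 ⊗ₜ j.1))
      = ∑ k ∈ Rp i.2, act (k.1 ⊗ₜ κ C H βinv (k.2 ⊗ₜ i.1)) := by
    intro i
    rw [Finset.sum_comm]
    refine Finset.sum_congr rfl fun k _ => ?_
    simpa using cou_r i.1 (act ∘ₗ TensorProduct.mk ℂ C H k.1 ∘ₗ κ C H βinv ∘ₗ
      TensorProduct.mk ℂ C C k.2)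
  simp only [← Finset.smul_sum] at l ⊢
  simp only [l]
  have := coas c (act ∘ₗ LinearMap.lTensor C (κ C H βinv ∘ₗ
      (TensorProduct.comm ℂ C C).toLinearMap) ∘ₗ (TensorProduct.assoc ℂ C C C).toLinearMap ∘ₗ
      LinearMap.rTensor C (TensorProduct.comm ℂ C C).toLinearMap ∘ₗ
      (TensorProduct.assoc ℂ C C C).symm.toLinearMap)
  simp at this
  rw [this]

/-- `a ⊗ b ↦ κ(a⁽²⁾ ⊗ b⁽¹⁾) ⊗ κ(a⁽¹⁾ ⊗ b⁽²⁾)` -/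
def G4 (βinv : C ⊗[ℂ] C →ₗ[ℂ] C ⊗[ℂ] H) : C ⊗[ℂ] C →ₗ[ℂ] H ⊗[ℂ] H :=
  TensorProduct.map (κ C H βinv) (κ C H βinv) ∘ₗ
    (TensorProduct.tensorTensorTensorComm ℂ C C C C).toLinearMap ∘ₗ
    TensorProduct.map ((TensorProduct.comm ℂ C C).toLinearMap ∘ₗ comul (R := ℂ)) (comul (R := ℂ))

/-- `a ⊗ (x ⊗ y) ↦ κ(a⁽²⁾ ⊗ x) ⊗ κ(a⁽¹⁾ ⊗ y)` -/
def G4' (βinv : C ⊗[ℂ] C →ₗ[ℂ] C ⊗[ℂ] H) : C ⊗[ℂ] (C ⊗[ℂ] C) →ₗ[ℂ] H ⊗[ℂ] H :=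
  TensorProduct.map (κ C H βinv) (κ C H βinv) ∘ₗ
    (TensorProduct.tensorTensorTensorComm ℂ C C C C).toLinearMap ∘ₗ
    LinearMap.rTensor (C ⊗[ℂ] C) ((TensorProduct.comm ℂ C C).toLinearMap ∘ₗ comul (R := ℂ))

lemma G4'_apply (a x y : C) : G4' (H := H) βinv (a ⊗ₜ (x ⊗ₜ y))
    = ∑ i ∈ Rp a, κ C H βinv (i.2 ⊗ₜ x) ⊗ₜ[ℂ] κ C H βinv (i.1 ⊗ₜ y) := by
  simp [G4', comul_eq, sum_tmul]

lemma G4_apply' (a b : C) : G4 (H := H) βinv (a ⊗ₜ b) = G4' βinv (a ⊗ₜ comul (R := ℂ) b) := by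
  simp [G4, G4']

lemma G4_apply (a b : C) : G4 (H := H) βinv (a ⊗ₜ b)
    = ∑ j ∈ Rp b, ∑ i ∈ Rp a, κ C H βinv (i.2 ⊗ₜ j.1) ⊗ₜ[ℂ] κ C H βinv (i.1 ⊗ₜ j.2) := by
  rw [G4_apply', comul_eq b]
  simp only [tmul_sum, map_sum, G4'_apply]

lemma G4_aux (hg : IsGaloisCoextension C D H act π βinv) (c : C) (g g' : H) :
    ∑ i ∈ Rp c, ∑ p ∈ Rp i.2, G4' βinv (i.1 ⊗ₜ (act (p.1 ⊗ₜ g) ⊗ₜ act (p.2 ⊗ₜ g')))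
      = counit (R := ℂ) c • (g ⊗ₜ[ℂ] g') := by
  have h1 := coas c (G4' βinv ∘ₗ LinearMap.lTensor C (TensorProduct.map (ac act g) (ac act g')))
  simp only [LinearMap.comp_apply, LinearMap.lTensor_tmul, map_tmul, ac_apply] at h1
  rw [← h1]
  simp only [G4'_apply]
  -- inner: `∑_{j ∈ i.1} ∑_{k ∈ j.1} κ(k.2 ⊗ j.2 g) ⊗ κ(k.1 ⊗ i.2 g')`
  have h2 : ∀ i : C × C, ∑ j ∈ Rp i.1, ∑ k ∈ Rp j.1,
      κ C H βinv (k.2 ⊗ₜ act (j.2 ⊗ₜ g)) ⊗ₜ[ℂ] κ C H βinv (k.1 ⊗ₜ act (i.2 ⊗ₜ g'))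
      = g ⊗ₜ[ℂ] κ C H βinv (i.1 ⊗ₜ act (i.2 ⊗ₜ g')) := by
    intro i
    have := coas i.1 ((TensorProduct.comm ℂ H H).toLinearMap ∘ₗ
      TensorProduct.map (κ C H βinv ∘ₗ (TensorProduct.mk ℂ C C).flip (act (i.2 ⊗ₜ g')))
        (κ C H βinv ∘ₗ LinearMap.lTensor C (ac act g)))
    simp at this
    rw [this]
    simp only [← sum_tmul, κ_sum hg]
    simpa [smul_tmul'] using cou_r i.1 (TensorProduct.mk ℂ H H g ∘ₗ κ C H βinv ∘ₗ
      (TensorProduct.mk ℂ C C).flip (act (i.2 ⊗ₜ g')))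
  simp only [h2, ← tmul_sum, κ_sum hg, tmul_smul]

lemma G4_β (hg : IsGaloisCoextension C D H act π βinv) (c : C) (h : H) :
    G4 βinv (βcan C H act (c ⊗ₜ h)) = counit (R := ℂ) c • comul (R := ℂ) h := by
  simp only [β_tmul, map_sum, G4_apply', comul_ac hg, tmul_sum]
  have : ∀ i : C × C, ∑ p ∈ Rp i.2, ∑ q ∈ Rp h,
      G4' βinv (i.1 ⊗ₜ (act (p.1 ⊗ₜ q.1) ⊗ₜ act (p.2 ⊗ₜ q.2)))
      = ∑ q ∈ Rp h, ∑ p ∈ Rp i.2,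
      G4' βinv (i.1 ⊗ₜ (act (p.1 ⊗ₜ q.1) ⊗ₜ act (p.2 ⊗ₜ q.2))) := fun i => Finset.sum_comm
  simp only [this]
  rw [Finset.sum_comm]
  simp only [G4_aux hg, comul_eq h, Finset.smul_sum]

lemma ρ_coassoc (hg : IsGaloisCoextension C D H act π βinv) {c : C} (hc : c ∈ CD C D π) :
    (TensorProduct.assoc ℂ H H C)
          (LinearMap.rTensor C (Coalgebra.comul (R := ℂ)) (ρmap C H βinv c))
        = LinearMap.lTensor H (ρmap C H βinv) (ρmap C H βinv c) := by
  have key := W_transfer hg (comul (R := ℂ) ∘ₗ κ C H βinv) (G4 βinv)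
    (fun c h => by rw [G4_β hg, LinearMap.comp_apply, κ_β hg, map_smul]) hc
  rw [LinearMap.rTensor_comp, LinearMap.comp_apply] at key
  rw [ρmap, LinearMap.comp_apply, key, W_eq]
  simp only [map_sum, LinearMap.rTensor_tmul, G4_apply, sum_tmul, assoc_tmul,
    LinearMap.lTensor_tmul, LinearMap.comp_apply, W_eq, tmul_sum]
  -- LHS `∑ i ∈ c, ∑ j ∈ i.1, ∑ k ∈ j.1, ∑ l ∈ i.2, κ(l.2 ⊗ k.1) ⊗ κ(l.1 ⊗ k.2) ⊗ j.2`
  -- RHS `∑ i ∈ c, ∑ j ∈ i.1, ∑ k ∈ j.2, ∑ l ∈ k.1, κ(i.2 ⊗ j.1) ⊗ κ(k.2 ⊗ l.1) ⊗ l.2`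
  -- `((a, b), (d, (e, f))) ↦ κ(f ⊗ a) ⊗ (κ(e ⊗ b) ⊗ d)`
  let E : ((C ⊗[ℂ] C) ⊗[ℂ] C) ⊗[ℂ] (C ⊗[ℂ] C) →ₗ[ℂ] H ⊗[ℂ] (H ⊗[ℂ] C) :=
    (TensorProduct.assoc ℂ H H C).toLinearMap ∘ₗ
    LinearMap.rTensor C (TensorProduct.map (κ C H βinv) (κ C H βinv) ∘ₗ
      (TensorProduct.tensorTensorTensorComm ℂ C C C C).toLinearMap ∘ₗ
      LinearMap.rTensor (C ⊗[ℂ] C) (TensorProduct.comm ℂ C C).toLinearMap ∘ₗ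
      (TensorProduct.comm ℂ (C ⊗[ℂ] C) (C ⊗[ℂ] C)).toLinearMap) ∘ₗ
    (TensorProduct.assoc ℂ (C ⊗[ℂ] C) (C ⊗[ℂ] C) C).symm.toLinearMap ∘ₗ
    LinearMap.lTensor (C ⊗[ℂ] C) (TensorProduct.comm ℂ C (C ⊗[ℂ] C)).toLinearMap ∘ₗ
    (TensorProduct.assoc ℂ (C ⊗[ℂ] C) C (C ⊗[ℂ] C)).toLinearMap
  have sA : ∀ i : C × C, ∑ j ∈ Rp i.1, ∑ k ∈ Rp j.2, ∑ l ∈ Rp k.1,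
      κ C H βinv (i.2 ⊗ₜ j.1) ⊗ₜ[ℂ] (κ C H βinv (k.2 ⊗ₜ l.1) ⊗ₜ[ℂ] l.2)
      = ∑ j ∈ Rp i.1, ∑ k ∈ Rp j.1, ∑ l ∈ Rp k.2,
      κ C H βinv (i.2 ⊗ₜ k.1) ⊗ₜ[ℂ] (κ C H βinv (j.2 ⊗ₜ l.1) ⊗ₜ[ℂ] l.2) := by
    intro i
    have := coas i.1 (TensorProduct.map (κ C H βinv ∘ₗ TensorProduct.mk ℂ C C i.2)
      (LinearMap.rTensor C (κ C H βinv) ∘ₗ (TensorProduct.assoc ℂ C C C).symm.toLinearMap ∘ₗ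
        (TensorProduct.comm ℂ (C ⊗[ℂ] C) C).toLinearMap ∘ₗ
        LinearMap.rTensor C (comul (R := ℂ))))
    simp [comul_eq, sum_tmul, tmul_sum] at this
    exact this.symm
  have sB : ∀ i j : C × C, ∑ k ∈ Rp j.1, ∑ l ∈ Rp k.2,
      κ C H βinv (i.2 ⊗ₜ k.1) ⊗ₜ[ℂ] (κ C H βinv (j.2 ⊗ₜ l.1) ⊗ₜ[ℂ] l.2)
      = ∑ k ∈ Rp j.1, ∑ l ∈ Rp k.1,
      κ C H βinv (i.2 ⊗ₜ l.1) ⊗ₜ[ℂ] (κ C H βinv (j.2 ⊗ₜ l.2) ⊗ₜ[ℂ] k.2) := by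
    intro i j
    have := coas j.1 (TensorProduct.map (κ C H βinv ∘ₗ TensorProduct.mk ℂ C C i.2)
      (LinearMap.rTensor C (κ C H βinv ∘ₗ TensorProduct.mk ℂ C C j.2)))
    simp at this
    exact this.symm
  simp only [sA, sB]
  have sC := coas c (E ∘ₗ LinearMap.rTensor (C ⊗[ℂ] C)
    (LinearMap.rTensor C (comul (R := ℂ)) ∘ₗ comul (R := ℂ)))
  simp [E, comul_eq, sum_tmul, tmul_sum] at sC
  rw [sC]
  refine Finset.sum_congr rfl fun i _ => ?_
  conv_rhs => rw [Finset.sum_comm]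
  exact Finset.sum_congr rfl fun k _ => Finset.sum_comm

/-- `a ⊗ b ↦ S(k) κ(a ⊗ b) h`. -/
def G5 (βinv : C ⊗[ℂ] C →ₗ[ℂ] C ⊗[ℂ] H) (k h : H) : C ⊗[ℂ] C →ₗ[ℂ] H :=
  LinearMap.mulLeft ℂ (HopfAlgebra.antipode ℂ k) ∘ₗ LinearMap.mulRight ℂ h ∘ₗ κ C H βinv

lemma FG5 (hg : IsGaloisCoextension C D H act π βinv) (k h : H) (c : C) (g : H) :
    (κ C H βinv ∘ₗ TensorProduct.map (ac act k) (ac act h)) (βcan C H act (c ⊗ₜ g))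
      = G5 βinv k h (βcan C H act (c ⊗ₜ g)) := by
  have e : G5 βinv k h (βcan C H act (c ⊗ₜ g))
      = counit (R := ℂ) c • (HopfAlgebra.antipode ℂ k * (g * h)) := by
    simp [G5, κ_β hg]
  rw [e]
  -- apply `κ β` to `c k⁽¹⁾ ⊗ S(k⁽²⁾) g h`
  have h1 : ∑ q ∈ Rp k, κ C H βinv (βcan C H act
      (act (c ⊗ₜ q.1) ⊗ₜ (HopfAlgebra.antipode ℂ q.2 * (g * h))))
      = counit (R := ℂ) c • (HopfAlgebra.antipode ℂ k * (g * h)) := by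
    simp only [κ_β hg, counit_ac hg, mul_smul, ← Finset.smul_sum]
    congr 1
    simpa [mul_assoc] using cou_l k (LinearMap.mulRight ℂ (g * h) ∘ₗ HopfAlgebra.antipode ℂ)
  rw [← h1, β_tmul]
  have h2 : ∀ x : C, ∀ k' y : H, βcan C H act (act (x ⊗ₜ k') ⊗ₜ y)
      = ∑ i ∈ Rp x, ∑ j ∈ Rp k', act (i.1 ⊗ₜ j.1) ⊗ₜ[ℂ] act (i.2 ⊗ₜ (j.2 * y)) := by
    intro x k' y
    simp only [βcan, LinearMap.comp_apply, LinearMap.rTensor_tmul, comul_ac hg, sum_tmul,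
      map_sum, LinearEquiv.coe_coe, assoc_tmul, LinearMap.lTensor_tmul, hg.act_mul]
  simp only [h2, map_sum]
  rw [Finset.sum_comm]
  refine Finset.sum_congr rfl fun i _ => ?_
  have h3 := coas k (κ C H βinv ∘ₗ TensorProduct.map (act ∘ₗ TensorProduct.mk ℂ C H i.1)
    (act ∘ₗ TensorProduct.mk ℂ C H i.2 ∘ₗ LinearMap.mulRight ℂ (g * h) ∘ₗ LinearMap.mul' ℂ H ∘ₗ
      LinearMap.lTensor H (HopfAlgebra.antipode ℂ)))
  simp [mul_assoc] at h3
  rw [h3]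
  simp only [← mul_assoc, ← tmul_sum, ← map_sum, ← Finset.sum_mul, antip]
  simp only [smul_mul_assoc, one_mul, tmul_smul, map_smul, LinearMap.comp_apply, map_tmul,
    ac_apply, hg.act_mul]
  simpa using (cou_r k (κ C H βinv ∘ₗ (TensorProduct.mk ℂ C C).flip (act (i.2 ⊗ₜ (g * h))) ∘ₗ
    act ∘ₗ TensorProduct.mk ℂ C H i.1)).symm

lemma ayd_apply (k : H) (c : C) (h : H) : aydRHS C H act ((k ⊗ₜ c) ⊗ₜ h)
    = ∑ q ∈ Rp h, ∑ r ∈ Rp q.1, (HopfAlgebra.antipode ℂ q.2 * (k * r.1)) ⊗ₜ[ℂ] act (c ⊗ₜ r.2) := by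
  simp [aydRHS, Θ, comul_eq, sum_tmul, tmul_sum]

lemma ayd (hg : IsGaloisCoextension C D H act π βinv) {c : C} (hc : c ∈ CD C D π) (h : H) :
    ρmap C H βinv (act (c ⊗ₜ[ℂ] h)) = aydRHS C H act ((ρmap C H βinv c) ⊗ₜ[ℂ] h) := by
  have e1 : ∀ w : (C ⊗[ℂ] C) ⊗[ℂ] C,
      aydRHS C H act ((LinearMap.rTensor C (κ C H βinv) w) ⊗ₜ[ℂ] h)
      = ∑ q ∈ Rp h, ∑ r ∈ Rp q.1, LinearMap.lTensor H (ac act r.2)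
        (LinearMap.rTensor C (G5 βinv q.2 r.1) w) := by
    intro w
    induction w using TensorProduct.induction_on with
    | zero => simp
    | add x y hx hy => simp only [map_add, add_tmul, hx, hy, Finset.sum_add_distrib]
    | tmul x y => simp [ayd_apply, G5]
  have e2 : W C (act (c ⊗ₜ h)) = ∑ q ∈ Rp h, ∑ r ∈ Rp q.1,
      TensorProduct.map (TensorProduct.map (ac act q.2) (ac act r.1)) (ac act r.2) (W C c) := by
    rw [W_eq c]
    simp only [W, LinearMap.comp_apply, comul_ac hg, sum_tmul,
      map_sum, LinearEquiv.coe_coe, LinearMap.rTensor_tmul, tmul_sum, comm_tmul,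
      assoc_symm_tmul, map_tmul, ac_apply]
    rw [Finset.sum_comm]
    refine Finset.sum_congr rfl fun q _ => ?_
    conv_rhs => rw [Finset.sum_comm]
    exact Finset.sum_congr rfl fun i _ => Finset.sum_comm
  conv_rhs => rw [ρmap, LinearMap.comp_apply, e1]
  rw [ρmap, LinearMap.comp_apply, e2]
  simp only [map_sum]
  refine Finset.sum_congr rfl fun q _ => Finset.sum_congr rfl fun r _ => ?_
  rw [← W_transfer hg _ _ (FG5 hg q.2 r.1) hc]
  generalize W C c = w
  induction w using TensorProduct.induction_on with
  | zero => simp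
  | add x y hx hy => simp only [map_add, hx, hy]
  | tmul x y => simp

end helpers

/-!
STATEMENT 16: In the Hopf–Galois coextension setting, for `c ∈ C^D` the
element `c⁽³⁾ ⊗ c⁽¹⁾` lies in `C □_D C`, and
`ρ(c) = κ(c⁽³⁾ ⊗ c⁽¹⁾) ⊗ c⁽²⁾` takes values in `H ⊗ C^D` and makes `C^D`, with
the restricted right `H`-action, a right-left stable anti-Yetter–Drinfeld
module over `H`.
-/
theorem CD_sayd {C D H : Type*} [Ring H] [HopfAlgebra ℂ H]
    [AddCommGroup C] [Module ℂ C] [Coalgebra ℂ C]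
    [AddCommGroup D] [Module ℂ D] [Coalgebra ℂ D]
    (act : C ⊗[ℂ] H →ₗ[ℂ] C) (π : C →ₗ[ℂ] D)
    (βinv : C ⊗[ℂ] C →ₗ[ℂ] C ⊗[ℂ] H)
    (hgal : IsGaloisCoextension C D H act π βinv) :
    -- the element `c⁽³⁾ ⊗ c⁽¹⁾` (with coefficient `c⁽²⁾`) lies in `C □_D C`
    (∀ c ∈ CD C D π,
      W C c ∈ LinearMap.range (LinearMap.rTensor C (cot C D π).subtype)) ∧
    -- `ρ` takes values in `H ⊗ C^D`
    (∀ c ∈ CD C D π,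
      ρmap C H βinv c ∈ LinearMap.range (LinearMap.lTensor H (CD C D π).subtype)) ∧
    -- (a) `ρ` is a coassociative and counital left `H`-coaction on `C^D`
    (∀ c ∈ CD C D π,
      (TensorProduct.assoc ℂ H H C)
          (LinearMap.rTensor C (Coalgebra.comul (R := ℂ)) (ρmap C H βinv c))
        = LinearMap.lTensor H (ρmap C H βinv) (ρmap C H βinv c)) ∧
    (∀ c ∈ CD C D π,
      (TensorProduct.lid ℂ C)
          (LinearMap.rTensor C (Coalgebra.counit (R := ℂ)) (ρmap C H βinv c)) = c) ∧
    -- (b) the anti-Yetter–Drinfeld condition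
    (∀ c ∈ CD C D π, ∀ h : H,
      act (c ⊗ₜ[ℂ] h) ∈ CD C D π ∧
      ρmap C H βinv (act (c ⊗ₜ[ℂ] h))
        = aydRHS C H act ((ρmap C H βinv c) ⊗ₜ[ℂ] h)) ∧
    -- (c) stability
    (∀ c ∈ CD C D π,
      act ((TensorProduct.comm ℂ H C) (ρmap C H βinv c)) = c) := by
  exact ⟨fun c hc => W_mem hc, fun c hc => ρ_mem hgal hc, fun c hc => ρ_coassoc hgal hc,
    fun c hc => κ_counit hgal hc, fun c hc h => ⟨ac_mem_CD hgal hc h, ayd hgal hc h⟩,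
    fun c hc => stab hgal hc⟩

end Gal
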